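/- For fixed primes n and p ≥ 3, the subgroup commutativity degree of ZM(p^α, n, r_α) tends to 0 as α → ∞; equivalently, (τ(p^α)² + 2τ(p^α)σ(p^α) + g(p^α)) / (τ(p^α) + σ(p^α))² → 0 as α → ∞. -/

import Mathlib

open Pointwise Filter

/-- The relators of the Zassenhaus metacyclic group
`ZM(m,n,r) = ⟨a, b | a^m = b^n = 1, b⁻¹ab = a^r⟩`. -/
def ZMrel (m n r : ℕ) : Set (FreeGroup (Fin 2)) :=
  {FreeGroup.of 0 ^ m, FreeGroup.of 1 ^ n,
   (FreeGroup.of 1)⁻¹ * FreeGroup.of 0 * FreeGroup.of 1 * (FreeGroup.of 0 ^ r)⁻¹}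

/-- The ZM-group `ZM(m,n,r)` as a presented group. -/
abbrev ZM (m n r : ℕ) : Type := PresentedGroup (ZMrel m n r)

/-- The generator `a` of `ZM(m,n,r)`. -/
def za (m n r : ℕ) : ZM m n r := PresentedGroup.of 0

/-- The generator `b` of `ZM(m,n,r)`. -/
def zb (m n r : ℕ) : ZM m n r := PresentedGroup.of 1

theorem IsCyclic.card_subgroup_le_card_divisors (C : Type*) [Group C] [IsCyclic C] [Finite C] :
    Nat.card (Subgroup C) ≤ (Nat.card C).divisors.card := by
  classical
  have := Fintype.ofFinite C
  have key : ∀ H : Subgroup C,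
      (H : Set C) = ({x : C | x ^ Nat.card H = 1} : Finset C) := by
    intro H
    have hsub : (H : Set C).toFinset ⊆ ({x : C | x ^ Nat.card H = 1} : Finset C) := by
      intro x hx
      have hx : x ∈ H := by simpa using hx
      have := pow_card_eq_one' (x := (⟨x, hx⟩ : H))
      exact Finset.mem_filter.mpr ⟨Finset.mem_univ _, congrArg Subtype.val this⟩
    have hcard : ({x : C | x ^ Nat.card H = 1} : Finset C).card ≤ (H : Set C).toFinset.card := by
      refine (IsCyclic.card_pow_eq_one_le Nat.card_pos).trans (le_of_eq ?_)
      rw [Set.toFinset_card, ← Nat.card_eq_fintype_card]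
      rfl
    rw [← Finset.eq_of_subset_of_card_le hsub hcard, Set.coe_toFinset]
  have hinj : Function.Injective (fun H : Subgroup C =>
      (⟨Nat.card H, Nat.mem_divisors.mpr ⟨H.card_subgroup_dvd_card, Nat.card_pos.ne'⟩⟩ :
        (Nat.card C).divisors)) := by
    intro H K h
    have h : Nat.card H = Nat.card K := congrArg Subtype.val h
    apply SetLike.coe_injective
    rw [key H, key K, h]
  exact (Nat.card_le_card_of_injective _ hinj).trans (Nat.card_eq_card_toFinset _).le |>.trans
    (by simp)

namespace Subgroup

variable {G : Type*} [Group G]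

theorem sup_eq_top_of_index_prime {A H : Subgroup G} (hA : A.index.Prime) (hH : ¬ H ≤ A) :
    H ⊔ A = ⊤ := by
  rw [← index_eq_one]
  have h := relIndex_mul_index (le_sup_right : A ≤ H ⊔ A)
  rcases (Nat.dvd_prime hA).mp ⟨_, (mul_comm _ _).trans h |>.symm⟩ with h1 | h1
  · exact h1
  · rw [h1] at h
    have : A.relIndex (H ⊔ A) = 1 := Nat.eq_of_mul_eq_mul_right hA.pos (by simpa using h)
    exact absurd (le_sup_left.trans (relIndex_eq_one.mp this)) hH

theorem eq_inf_sup_zpowers {A H : Subgroup G} [A.Normal] (hA : A.index.Prime) {x : G}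
    (hx : x ∈ H) (hxA : x ∉ A) : H = H ⊓ A ⊔ zpowers x := by
  have hxH : zpowers x ≤ H := by simpa using hx
  apply le_antisymm _ (sup_le inf_le_left hxH)
  intro h hh
  have htop := sup_eq_top_of_index_prime (H := zpowers x) hA (by simpa using hxA)
  obtain ⟨y, hy, z, hz, rfl⟩ := mem_sup_of_normal_right.mp (htop ▸ mem_top h)
  have hzH : z ∈ H := by simpa using H.mul_mem (H.inv_mem (hxH hy)) hh
  exact mul_mem (mem_sup_right hy) (mem_sup_left ⟨hzH, hz⟩)

theorem card_coe_mul_coe (H K : Subgroup G) :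
    Nat.card ((H : Set G) * (K : Set G) : Set G) = Nat.card K * K.relIndex H := by
  rw [card_mul_eq_card_subgroup_mul_card_quotient]
  congr 1
  have hst : MulAction.stabilizer H ((1 : G) : G ⧸ K) = K.subgroupOf H := by
    ext h
    simp only [MulAction.mem_stabilizer_iff, mem_subgroupOf]
    change ((h * 1 : G) : G ⧸ K) = _ ↔ _
    rw [eq_comm, QuotientGroup.eq]
    simp
  rw [relIndex, ← hst, MulAction.index_stabilizer]
  change Set.ncard _ = _
  congr 1
  ext q
  constructor
  · rintro ⟨h, hh, rfl⟩
    exact ⟨⟨h, hh⟩, congrArg _ (mul_one h)⟩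
  · rintro ⟨h, rfl⟩
    exact ⟨h, h.2, congrArg _ (mul_one (h : G)).symm⟩

theorem card_coe_mul_coe_dvd_card {H K : Subgroup G}
    (h : (H : Set G) * (K : Set G) = (K : Set G) * (H : Set G)) :
    Nat.card ((H : Set G) * (K : Set G) : Set G) ∣ Nat.card G := by
  let T : Subgroup G :=
    { carrier := (H : Set G) * (K : Set G)
      mul_mem' := by
        intro x y hx hy
        have : x * y ∈ ((H : Set G) * (K : Set G)) * ((H : Set G) * (K : Set G)) :=
          Set.mul_mem_mul hx hy
        rwa [mul_assoc, ← mul_assoc (K : Set G), ← h, mul_assoc (H : Set G) (K : Set G),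
          coe_mul_coe, ← mul_assoc, coe_mul_coe] at this
      one_mem' := ⟨1, H.one_mem, 1, K.one_mem, mul_one 1⟩
      inv_mem' := by
        rintro _ ⟨x, hx, y, hy, rfl⟩
        rw [h]
        exact ⟨y⁻¹, K.inv_mem hy, x⁻¹, H.inv_mem hx, (mul_inv_rev x y).symm⟩ }
  exact T.card_subgroup_dvd_card

theorem relIndex_eq_index_of_prime {A H : Subgroup G} [A.Normal] (hA : A.index.Prime)
    (hH : ¬ H ≤ A) : A.relIndex H = A.index :=
  ((Nat.dvd_prime hA).mp (relIndex_dvd_index_of_normal A H)).resolve_left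
    (mt relIndex_eq_one.mp hH)

theorem not_inf_le_of_mul_comm {A H K : Subgroup G} [A.Normal] [Finite G] (hA : A.index.Prime)
    (hcop : (Nat.card A).Coprime A.index) (hH : ¬ H ≤ A) (hK : ¬ K ≤ A)
    (h : (H : Set G) * (K : Set G) = (K : Set G) * (H : Set G)) : ¬ H ⊓ K ≤ A := by
  intro hle
  have h1 : A.index ∣ K.relIndex H := by
    rw [← inf_relIndex_left, ← relIndex_eq_index_of_prime hA hH, ← inf_relIndex_left H A]
    exact relIndex_dvd_of_le_left _ (le_inf inf_le_left hle)
  have h2 : A.index ∣ Nat.card K := by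
    rw [← relIndex_eq_index_of_prime hA hK]
    exact relIndex_dvd_card A K
  have h3 := (mul_dvd_mul h2 h1).trans (card_coe_mul_coe H K ▸ card_coe_mul_coe_dvd_card h)
  rw [← A.card_mul_index] at h3
  have h4 := Nat.dvd_of_mul_dvd_mul_right hA.pos h3
  exact hA.one_lt.ne' (Nat.eq_one_of_dvd_coprimes hcop.symm dvd_rfl h4)

theorem card_mul_comm_pairs_le {A : Subgroup G} [A.Normal] [Finite G] (hA : A.index.Prime)
    (hcop : (Nat.card A).Coprime A.index) :
    Nat.card {q : Subgroup G × Subgroup G //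
        (q.1 : Set G) * (q.2 : Set G) = (q.2 : Set G) * (q.1 : Set G)} ≤
      4 * Nat.card (Subgroup A) ^ 2 * Nat.card A := by
  classical
  obtain ⟨b, hb⟩ : ∃ b, b ∉ A := by
    by_contra! h
    exact hA.ne_one (index_eq_one.mpr ((eq_top_iff' A).mpr h))
  let e : Subgroup A → Bool → A → Subgroup G :=
    fun U s c => U.map A.subtype ⊔ if s then zpowers (b * c) else ⊥
  let f : Subgroup A × Subgroup A × A × Bool × Bool → Subgroup G × Subgroup G :=
    fun t => (e t.1 t.2.2.2.1 t.2.2.1, e t.2.1 t.2.2.2.2 t.2.2.1)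
  have he : ∀ H : Subgroup G, ∀ c, H ≤ A → e (H.subgroupOf A) false c = H := by
    intro H c hH
    simp [e, subgroupOf_map_subtype, hH]
  have hmem : ∀ H : Subgroup G, ¬ H ≤ A → ∃ c : A, b * c ∈ H := by
    intro H hH
    have htop := sup_eq_top_of_index_prime hA hH
    obtain ⟨y, hy, z, hz, hyz⟩ := mem_sup_of_normal_right.mp (htop ▸ mem_top b)
    exact ⟨⟨z, hz⟩⁻¹, by simpa [← hyz] using hy⟩
  have he' : ∀ H : Subgroup G, ∀ c : A, b * c ∈ H → e (H.subgroupOf A) true c = H := by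
    intro H c hH
    have hbc : b * c ∉ A := by rwa [A.mul_mem_cancel_right c.2]
    simpa [e, subgroupOf_map_subtype] using (eq_inf_sup_zpowers hA hH hbc).symm
  have hf : ∀ q : {q : Subgroup G × Subgroup G //
      (q.1 : Set G) * (q.2 : Set G) = (q.2 : Set G) * (q.1 : Set G)}, ∃ t, f t = q.1 := by
    rintro ⟨⟨H, K⟩, hq⟩
    by_cases hH : H ≤ A <;> by_cases hK : K ≤ A
    · exact ⟨(H.subgroupOf A, K.subgroupOf A, 1, false, false),
        Prod.ext (he H 1 hH) (he K 1 hK)⟩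
    · obtain ⟨c, hc⟩ := hmem K hK
      exact ⟨(H.subgroupOf A, K.subgroupOf A, c, false, true),
        Prod.ext (he H c hH) (he' K c hc)⟩
    · obtain ⟨c, hc⟩ := hmem H hH
      exact ⟨(H.subgroupOf A, K.subgroupOf A, c, true, false),
        Prod.ext (he' H c hc) (he K c hK)⟩
    · obtain ⟨c, hc⟩ := hmem _ (not_inf_le_of_mul_comm hA hcop hH hK hq)
      exact ⟨(H.subgroupOf A, K.subgroupOf A, c, true, true),
        Prod.ext (he' H c hc.1) (he' K c hc.2)⟩
  choose g hg using hf
  have hinj : Function.Injective g := by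
    intro q q' h
    exact Subtype.ext ((hg q).symm.trans ((congrArg f h).trans (hg q')))
  refine (Nat.card_le_card_of_injective g hinj).trans (le_of_eq ?_)
  simp only [Nat.card_prod, Nat.card_eq_fintype_card (α := Bool), Fintype.card_bool]
  ring

end Subgroup

theorem orderOf_le_card_subgroup {G : Type*} [Group G] [Finite G] {n r : ℕ} {a b : G}
    (φ : G →* Multiplicative (ZMod n)) (ha : φ a = 1) (hb : φ b = Multiplicative.ofAdd 1)
    (hbn : b ^ n = 1) (hab : b⁻¹ * a * b = a ^ r) (hr : 0 < r)
    (hcop : (orderOf a).Coprime (r - 1)) : orderOf a ≤ Nat.card (Subgroup G) := by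
  have hinj : Function.Injective (fun c : Subgroup.zpowers a =>
      Subgroup.zpowers ((c : G) * b * (c : G)⁻¹)) := by
    rintro ⟨_, i, rfl⟩ ⟨_, j, rfl⟩ h
    simp only at h
    have hmem : a ^ j * b * (a ^ j)⁻¹ ∈ Subgroup.zpowers (a ^ i * b * (a ^ i)⁻¹) := by
      rw [h]; exact Subgroup.mem_zpowers _
    obtain ⟨k, hk⟩ := hmem
    have hk : a ^ i * b ^ k * (a ^ i)⁻¹ = a ^ j * b * (a ^ j)⁻¹ := by
      rw [← hk]; exact (conj_zpow).symm
    have hφ := congrArg φ hk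
    have hbk : b ^ k = b := by
      simp only [map_mul, map_zpow, map_inv, ha, hb, one_zpow, one_mul, inv_one, mul_one] at hφ
      have hz : (k : ZMod n) = 1 := by
        have := congrArg Multiplicative.toAdd hφ
        simpa using this
      have hd : (n : ℤ) ∣ k - 1 := by
        rw [← ZMod.intCast_zmod_eq_zero_iff_dvd]
        push_cast
        rw [hz, sub_self]
      obtain ⟨t, ht⟩ := hd
      rw [show k = 1 + n * t by omega, zpow_add, zpow_mul, zpow_natCast, hbn, one_zpow, zpow_one,
        mul_one]
    rw [hbk] at hk
    have hcomm : b⁻¹ * a ^ (i - j) * b = a ^ (i - j) := by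
      have h' : a ^ i * b = a ^ j * b * (a ^ j)⁻¹ * a ^ i := by rw [← hk]; group
      rw [sub_eq_neg_add, zpow_add, mul_assoc, mul_assoc, h']
      group
    have hconj : b⁻¹ * a ^ (i - j) * b = (a ^ r) ^ (i - j) := by
      rw [← hab]
      simpa using (conj_zpow (a := b⁻¹) (b := a) (i := i - j)).symm
    have h1 : a ^ (((r - 1 : ℕ) : ℤ) * (i - j)) = 1 := by
      rw [Nat.cast_sub hr, sub_mul, zpow_sub, zpow_mul, zpow_natCast, ← hconj, hcomm]
      simp
    have h2 := (Int.isCoprime_iff_gcd_eq_one.mpr (by simpa using hcop)).dvd_of_dvd_mul_left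
      (orderOf_dvd_iff_zpow_eq_one.mpr h1)
    apply Subtype.ext
    have := orderOf_dvd_iff_zpow_eq_one.mp h2
    rw [zpow_sub] at this
    exact mul_inv_eq_one.mp this
  simpa using Nat.card_le_card_of_injective _ hinj

section Presentation

variable (m n r : ℕ)

theorem za_pow : za m n r ^ m = 1 :=
  PresentedGroup.one_of_mem (rels := ZMrel m n r) (by simp [ZMrel])

theorem zb_pow : zb m n r ^ n = 1 :=
  PresentedGroup.one_of_mem (rels := ZMrel m n r) (by simp [ZMrel])

theorem zb_inv_mul_za_mul_zb : (zb m n r)⁻¹ * za m n r * zb m n r = za m n r ^ r := by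
  rw [← mul_inv_eq_one]
  exact PresentedGroup.one_of_mem (rels := ZMrel m n r) (by simp [ZMrel])

variable {m n r}

/-- The homomorphism out of `ZM(m,n,r)` determined by two elements satisfying the relations. -/
def ZM.lift {G : Type*} [Group G] (x y : G) (hx : x ^ m = 1) (hy : y ^ n = 1)
    (hxy : y⁻¹ * x * y = x ^ r) : ZM m n r →* G :=
  PresentedGroup.toGroup (f := ![x, y]) (by
    rintro _ (rfl | rfl | rfl)
    · simpa using hx
    · simpa using hy
    · simpa [mul_inv_eq_one] using hxy)

section lift

variable {G : Type*} [Group G] (x y : G) (hx : x ^ m = 1) (hy : y ^ n = 1)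
  (hxy : y⁻¹ * x * y = x ^ r)

@[simp]
theorem ZM.lift_za : ZM.lift x y hx hy hxy (za m n r) = x :=
  PresentedGroup.toGroup.of _

@[simp]
theorem ZM.lift_zb : ZM.lift x y hx hy hxy (zb m n r) = y :=
  PresentedGroup.toGroup.of _

end lift

theorem orderOf_za (hr : r ^ n ≡ 1 [MOD m]) (hn : n ≠ 0) :
    orderOf (za m n r) = m := by
  apply Nat.dvd_antisymm (orderOf_dvd_of_pow_eq_one (za_pow m n r))
  have hcop : r.Coprime m := by
    have h : (r ^ n).gcd m = 1 := by rw [hr.gcd_eq]; simp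
    exact Nat.Coprime.coprime_dvd_left (dvd_pow_self r hn) h
  let u := ZMod.unitOfCoprime r hcop
  have hu : u ^ n = 1 := by
    ext
    simpa [u] using (ZMod.natCast_eq_natCast_iff _ _ _).mpr hr
  let x : Equiv.Perm (ZMod m) := Equiv.addRight 1
  have hxk : ∀ (k : ℕ) (t : ZMod m), (x ^ k) t = t + k := by
    intro k
    induction k with
    | zero => simp
    | succ k ih =>
      intro t
      rw [pow_succ, Equiv.Perm.mul_apply, ih]
      simp [x, add_right_comm, add_assoc]
  let y : Equiv.Perm (ZMod m) := MulAction.toPermHom (ZMod m)ˣ (ZMod m) u⁻¹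
  have hx : x ^ m = 1 := by
    ext t
    simp [hxk]
  have hy : y ^ n = 1 := by
    simp only [y]
    rw [← map_pow, inv_pow, hu, inv_one, map_one]
  have hxy : y⁻¹ * x * y = x ^ r := by
    ext t
    simp only [y]
    rw [← map_inv, inv_inv, hxk, Equiv.Perm.mul_apply, Equiv.Perm.mul_apply,
      MulAction.toPermHom_apply, MulAction.toPermHom_apply, MulAction.toPerm_apply,
      MulAction.toPerm_apply]
    simp only [x, Equiv.coe_addRight, smul_add, smul_inv_smul]
    simp [Units.smul_def, u]
  have h := pow_orderOf_eq_one (za m n r)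
  apply_fun ZM.lift x y hx hy hxy at h
  rw [map_pow, ZM.lift_za, map_one] at h
  have h0 := hxk (orderOf (za m n r)) 0
  rw [h] at h0
  rw [← ZMod.natCast_eq_zero_iff]
  simpa using h0.symm

theorem closure_za_zb : Subgroup.closure {za m n r, zb m n r} = ⊤ := by
  rw [← PresentedGroup.closure_range_of]
  congr 1
  ext g
  simp [za, zb, eq_comm]

theorem normal_zpowers_za (hm : 0 < m) : (Subgroup.zpowers (za m n r)).Normal := by
  have hfin : Finite (Subgroup.zpowers (za m n r)) :=
    finite_zpowers.mpr (isOfFinOrder_iff_pow_eq_one.mpr ⟨m, hm, za_pow m n r⟩)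
  rw [← Subgroup.normalizer_eq_top_iff, eq_top_iff, ← closure_za_zb, Subgroup.closure_le]
  rintro _ (rfl | rfl)
  · exact Subgroup.le_normalizer (Subgroup.mem_zpowers _)
  · rw [SetLike.mem_coe, ← inv_mem_iff]
    apply Subgroup.mem_normalizer_fintype
    rintro _ ⟨k, rfl⟩
    refine ⟨r * k, ?_⟩
    simp only
    rw [zpow_mul, zpow_natCast, ← zb_inv_mul_za_mul_zb]
    simpa using conj_zpow (a := (zb m n r)⁻¹) (b := za m n r) (i := k)

/-- The projection of `ZM(m,n,r)` onto the cyclic group of order `n` killing `a`. -/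
def ZM.proj (m n r : ℕ) : ZM m n r →* Multiplicative (ZMod n) :=
  ZM.lift 1 (Multiplicative.ofAdd 1) (one_pow _) (by rw [← ofAdd_nsmul]; simp) (by simp)

theorem ker_proj (hm : 0 < m) : (ZM.proj m n r).ker = Subgroup.zpowers (za m n r) := by
  have := normal_zpowers_za (n := n) (r := r) hm
  have hle : Subgroup.zpowers (za m n r) ≤ (ZM.proj m n r).ker := by
    simp [MonoidHom.mem_ker, ZM.proj]
  refine le_antisymm (fun g hg => ?_) hle
  have hg' : g ∈ Subgroup.zpowers (zb m n r) ⊔ Subgroup.zpowers (za m n r) := by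
    rw [Subgroup.zpowers_eq_closure, Subgroup.zpowers_eq_closure, ← Subgroup.closure_union,
      Set.union_comm, Set.singleton_union, closure_za_zb]
    trivial
  obtain ⟨_, ⟨k, rfl⟩, z, hz, rfl⟩ := Subgroup.mem_sup_of_normal_right.mp hg'
  have hk : ZM.proj m n r (zb m n r ^ k) = 1 := by
    have := MonoidHom.mem_ker.mp hg
    rwa [map_mul, MonoidHom.mem_ker.mp (hle hz), mul_one] at this
  have hz' : (k : ZMod n) = 0 := by
    rw [map_zpow, ZM.proj, ZM.lift_zb] at hk
    simpa using congrArg Multiplicative.toAdd hk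
  obtain ⟨t, rfl⟩ := (ZMod.intCast_zmod_eq_zero_iff_dvd k n).mp hz'
  simpa [zpow_mul, zb_pow] using hz

theorem index_zpowers_za (hm : 0 < m) : (Subgroup.zpowers (za m n r)).index = n := by
  rw [← ker_proj hm, Subgroup.index_ker, MonoidHom.range_eq_top.mpr, Subgroup.card_top]
  · exact (Nat.card_congr Multiplicative.toAdd).trans (Nat.card_zmod n)
  · intro t
    obtain ⟨k, hk⟩ := ZMod.intCast_surjective t.toAdd
    refine ⟨zb m n r ^ k, ?_⟩
    rw [map_zpow, ZM.proj, ZM.lift_zb, ← ofAdd_zsmul]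
    simp [hk]

end Presentation

theorem card_mul_comm_pairs_ZM_le {p n r α : ℕ} (hp : p.Prime) (hn : n.Prime)
    (hcop : (p ^ α).Coprime n) (hr : r ^ n ≡ 1 [MOD p ^ α]) :
    Nat.card {q : Subgroup (ZM (p ^ α) n r) × Subgroup (ZM (p ^ α) n r) //
        (q.1 : Set (ZM (p ^ α) n r)) * (q.2 : Set (ZM (p ^ α) n r)) =
          (q.2 : Set (ZM (p ^ α) n r)) * (q.1 : Set (ZM (p ^ α) n r))} ≤
      4 * (α + 1) ^ 2 * p ^ α := by
  have hm : 0 < p ^ α := pow_pos hp.pos α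
  have hA := normal_zpowers_za (n := n) (r := r) hm
  have hidx := index_zpowers_za (n := n) (r := r) hm
  have hcard : Nat.card (Subgroup.zpowers (za (p ^ α) n r)) = p ^ α := by
    rw [Nat.card_zpowers, orderOf_za hr hn.ne_zero]
  have hfin : Finite (ZM (p ^ α) n r) := by
    apply Nat.finite_of_card_ne_zero
    rw [← (Subgroup.zpowers (za (p ^ α) n r)).card_mul_index, hidx, hcard]
    exact mul_ne_zero hm.ne' hn.ne_zero
  have h := Subgroup.card_mul_comm_pairs_le (A := Subgroup.zpowers (za (p ^ α) n r))
    (by rwa [hidx]) (by rwa [hidx, hcard])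
  have h' := IsCyclic.card_subgroup_le_card_divisors (Subgroup.zpowers (za (p ^ α) n r))
  rw [hcard, Nat.divisors_prime_pow hp, Finset.card_map, Finset.card_range] at h'
  rw [hcard] at h
  exact h.trans (by gcongr)

theorem le_card_subgroup_ZM {m n r : ℕ} (hm : 0 < m) (hn : n ≠ 0) (hr0 : 0 < r)
    (hcop : m.Coprime (r - 1)) (hr : r ^ n ≡ 1 [MOD m]) :
    m ≤ Nat.card (Subgroup (ZM m n r)) := by
  have hord := orderOf_za hr hn
  have hfin : Finite (ZM m n r) := by
    apply Nat.finite_of_card_ne_zero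
    rw [← (Subgroup.zpowers (za m n r)).card_mul_index, index_zpowers_za hm, Nat.card_zpowers,
      hord]
    exact mul_ne_zero hm.ne' hn
  have h := orderOf_le_card_subgroup (ZM.proj m n r) (ZM.lift_za ..) (ZM.lift_zb ..)
    (zb_pow m n r) (zb_inv_mul_za_mul_zb m n r) hr0 (by rwa [hord])
  rwa [hord] at h

theorem tendsto_const_mul_sq_div_pow (C : ℝ) {p : ℝ} (hp : 1 < p) :
    Tendsto (fun α : ℕ => C * ((α : ℝ) + 1) ^ 2 / p ^ α) atTop (nhds 0) := by
  have h := ((tendsto_pow_const_div_const_pow_of_one_lt 2 hp).comp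
    (tendsto_add_atTop_nat 1)).const_mul (C * p)
  rw [mul_zero] at h
  refine h.congr fun α => ?_
  have : p ≠ 0 := by positivity
  simp only [Function.comp_apply]
  push_cast
  field_simp
  ring

theorem tendsto_zero_of_le_sq_mul_pow {N D : ℕ → ℝ} {C p : ℝ} (hp : 1 < p)
    (hN0 : ∀ α, 0 ≤ N α) (hN : ∀ α, N α ≤ C * ((α : ℝ) + 1) ^ 2 * p ^ α)
    (hD : ∀ α, p ^ α ≤ D α) : Tendsto (fun α => N α / D α ^ 2) atTop (nhds 0) := by
  refine squeeze_zero (fun α => div_nonneg (hN0 α) (sq_nonneg _)) (fun α => ?_)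
    (tendsto_const_mul_sq_div_pow C hp)
  have hpos : 0 < p ^ α := by positivity
  calc N α / D α ^ 2 ≤ C * ((α : ℝ) + 1) ^ 2 * p ^ α / (p ^ α) ^ 2 :=
        div_le_div₀ ((hN0 α).trans (hN α)) (hN α) (by positivity)
          (pow_le_pow_left₀ hpos.le (hD α) 2)
    _ = C * ((α : ℝ) + 1) ^ 2 / p ^ α := by field_simp

/-- For fixed primes `n` and `p ≥ 3`, the subgroup commutativity degree of
`ZM(p^α, n, r_α)` tends to `0` as `α → ∞`; equivalently, the explicit expression
`(τ(p^α)² + 2τ(p^α)σ(p^α) + g(p^α)) / (τ(p^α) + σ(p^α))²` tends to `0`. -/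
theorem sd_ZM_prime_pow_tendsto_zero (p n : ℕ) (hp : p.Prime) (hp3 : 3 ≤ p)
    (hn : n.Prime) (r : ℕ → ℕ) (hrpos : ∀ α, 0 < r α)
    (h1 : ∀ α, Nat.gcd (p ^ α) n = 1) (h2 : ∀ α, Nat.gcd (p ^ α) (r α - 1) = 1)
    (h3 : ∀ α, (r α) ^ n ≡ 1 [MOD p ^ α]) :
    Tendsto (fun α : ℕ =>
        (Nat.card {q : Subgroup (ZM (p ^ α) n (r α)) × Subgroup (ZM (p ^ α) n (r α)) //
            (q.1 : Set (ZM (p ^ α) n (r α))) * (q.2 : Set (ZM (p ^ α) n (r α))) =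
              (q.2 : Set (ZM (p ^ α) n (r α))) * (q.1 : Set (ZM (p ^ α) n (r α)))} : ℝ) /
          (Nat.card (Subgroup (ZM (p ^ α) n (r α))) : ℝ) ^ 2)
      atTop (nhds 0) ∧
    Tendsto (fun α : ℕ =>
        (((α : ℝ) + 1) ^ 2 +
            2 * ((α : ℝ) + 1) * (((p : ℝ) ^ (α + 1) - 1) / ((p : ℝ) - 1)) +
            ((2 * (α : ℝ) + 1) * (p : ℝ) ^ (α + 2) -
              (2 * (α : ℝ) + 3) * (p : ℝ) ^ (α + 1) + (p : ℝ) + 1) / ((p : ℝ) - 1) ^ 2) /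
          (((α : ℝ) + 1) + ((p : ℝ) ^ (α + 1) - 1) / ((p : ℝ) - 1)) ^ 2)
      atTop (nhds 0) := by
  have hp3' : (3 : ℝ) ≤ p := by exact_mod_cast hp3
  have hp1 : (1 : ℝ) < p := by linarith
  constructor
  · refine tendsto_zero_of_le_sq_mul_pow (C := 4) hp1 (fun α => Nat.cast_nonneg _)
      (fun α => ?_) (fun α => ?_)
    · exact_mod_cast card_mul_comm_pairs_ZM_le hp hn (h1 α) (h3 α)
    · exact_mod_cast le_card_subgroup_ZM (pow_pos hp.pos α) hn.ne_zero (hrpos α) (h2 α) (h3 α)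
  · have hσ : ∀ α : ℕ, (p : ℝ) ^ α ≤ ((p : ℝ) ^ (α + 1) - 1) / ((p : ℝ) - 1) := by
      intro α
      rw [le_div_iff₀ (by linarith), pow_succ]
      have : (1 : ℝ) ≤ (p : ℝ) ^ α := one_le_pow₀ hp1.le
      nlinarith
    have hσ' : ∀ α : ℕ, ((p : ℝ) ^ (α + 1) - 1) / ((p : ℝ) - 1) ≤ p * (p : ℝ) ^ α := by
      intro α
      have : (1 : ℝ) ≤ (p : ℝ) ^ α := one_le_pow₀ hp1.le
      rw [div_le_iff₀ (by linarith), pow_succ]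
      nlinarith [mul_nonneg (show (0 : ℝ) ≤ p * (p : ℝ) ^ α by positivity)
        (show (0 : ℝ) ≤ p - 2 by linarith)]
    have hg0 : ∀ α : ℕ, 0 ≤ (2 * (α : ℝ) + 1) * (p : ℝ) ^ (α + 2) -
        (2 * (α : ℝ) + 3) * (p : ℝ) ^ (α + 1) + (p : ℝ) + 1 := by
      intro α
      have hα : (0 : ℝ) ≤ α := Nat.cast_nonneg α
      have h : 0 ≤ ((2 * (α : ℝ) + 1) * p - (2 * α + 3)) * (p : ℝ) ^ (α + 1) :=
        mul_nonneg (by nlinarith) (by positivity)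
      have e : ((2 * (α : ℝ) + 1) * p - (2 * α + 3)) * (p : ℝ) ^ (α + 1) =
        (2 * (α : ℝ) + 1) * (p : ℝ) ^ (α + 2) - (2 * (α : ℝ) + 3) * (p : ℝ) ^ (α + 1) := by ring
      linarith
    have hg : ∀ α : ℕ, ((2 * (α : ℝ) + 1) * (p : ℝ) ^ (α + 2) -
        (2 * (α : ℝ) + 3) * (p : ℝ) ^ (α + 1) + (p : ℝ) + 1) / ((p : ℝ) - 1) ^ 2 ≤
        2 * p ^ 2 * ((α : ℝ) + 1) ^ 2 * (p : ℝ) ^ α := by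
      intro α
      have hα : (0 : ℝ) ≤ α := Nat.cast_nonneg α
      refine (div_le_self (hg0 α) (one_le_pow₀ (by linarith))).trans ?_
      have h1 : (p : ℝ) ≤ (p : ℝ) ^ (α + 1) := le_self_pow₀ hp1.le (by omega)
      have h2 : 3 * (p : ℝ) ^ (α + 1) ≤ (2 * (α : ℝ) + 3) * (p : ℝ) ^ (α + 1) := by
        gcongr; linarith
      have h3 : (2 * (α : ℝ) + 1) * (p : ℝ) ^ (α + 2) ≤
          2 * ((α : ℝ) + 1) ^ 2 * (p : ℝ) ^ (α + 2) := by
        gcongr; nlinarith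
      have e : 2 * p ^ 2 * ((α : ℝ) + 1) ^ 2 * (p : ℝ) ^ α =
        2 * ((α : ℝ) + 1) ^ 2 * (p : ℝ) ^ (α + 2) := by ring
      linarith
    refine tendsto_zero_of_le_sq_mul_pow (C := 1 + 2 * p + 2 * (p : ℝ) ^ 2) hp1
      (fun α => ?_) (fun α => ?_) (fun α => ?_)
    · have := (pow_nonneg (by linarith : (0 : ℝ) ≤ p) α).trans (hσ α)
      have := div_nonneg (hg0 α) (sq_nonneg ((p : ℝ) - 1))
      positivity
    · have h1 : (1 : ℝ) ≤ (p : ℝ) ^ α := one_le_pow₀ hp1.le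
      have hα : (0 : ℝ) ≤ α := Nat.cast_nonneg α
      have e1 : ((α : ℝ) + 1) ^ 2 ≤ ((α : ℝ) + 1) ^ 2 * (p : ℝ) ^ α :=
        le_mul_of_one_le_right (by positivity) h1
      have e2 : 2 * ((α : ℝ) + 1) * (((p : ℝ) ^ (α + 1) - 1) / ((p : ℝ) - 1)) ≤
          2 * ((α : ℝ) + 1) ^ 2 * (p * (p : ℝ) ^ α) :=
        mul_le_mul (by nlinarith) (hσ' α)
          ((pow_nonneg (by linarith : (0 : ℝ) ≤ p) α).trans (hσ α)) (by positivity)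
      linarith [hg α]
    · have hα : (0 : ℝ) ≤ α := Nat.cast_nonneg α
      linarith [hσ α]
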